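/- arXiv:2105.09715 — 2 statements merged into one kernel-verified Lean document; each statement's English description precedes it below -/
import Mathlib

section
/- Let A ∈ B(H). If w(A) = ‖A‖/2, then for every θ ∈ ℝ one has ‖Re(e^{iθ}A)‖·‖Im(e^{iθ}A)‖ = (1/4)‖A*A − AA*‖. -/
open ContinuousLinearMap Filter
open scoped ComplexInnerProductSpace Topology

variable {H : Type*} [NormedAddCommGroup H] [InnerProductSpace ℂ H]
  [CompleteSpace H] [Nontrivial H]

/-- The numerical range of a bounded linear operator. -/
noncomputable def numRange (A : H →L[ℂ] H) : Set ℂ :=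
  {z : ℂ | ∃ x : H, ‖x‖ = 1 ∧ z = ⟪x, A x⟫}

/-- The numerical radius of a bounded linear operator. -/
noncomputable def numRadius (A : H →L[ℂ] H) : ℝ :=
  sSup {r : ℝ | ∃ x : H, ‖x‖ = 1 ∧ r = ‖(⟪x, A x⟫)‖}

/-- The Crawford number of a bounded linear operator. -/
noncomputable def crawford (A : H →L[ℂ] H) : ℝ :=
  sInf {r : ℝ | ∃ x : H, ‖x‖ = 1 ∧ r = ‖(⟪x, A x⟫)‖}

/-- The real part `(A + A*)/2` of a bounded linear operator. -/
noncomputable def reOp (A : H →L[ℂ] H) : H →L[ℂ] H :=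
  (2 : ℂ)⁻¹ • (A + ContinuousLinearMap.adjoint A)

/-- The imaginary part `(A - A*)/(2i)` of a bounded linear operator. -/
noncomputable def imOp (A : H →L[ℂ] H) : H →L[ℂ] H :=
  (2 * Complex.I)⁻¹ • (A - ContinuousLinearMap.adjoint A)

section

variable {E : Type*} [NormedAddCommGroup E] [InnerProductSpace ℂ E]

theorem norm_le_of_isSymmetric_of_abs_re_inner_le {T : E →L[ℂ] E}
    (hT : (T : E →ₗ[ℂ] E).IsSymmetric) {c : ℝ}
    (hc : 0 ≤ c) (h : ∀ x, |(⟪T x, x⟫).re| ≤ c * ‖x‖ ^ 2) : ‖T‖ ≤ c := by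
  rw [T.norm_eq_iSup_rayleighQuotient hT]
  have : Nonempty E := ⟨0⟩
  refine ciSup_le fun x => ?_
  rw [rayleighQuotient, reApplyInnerSelf_apply, abs_div, abs_sq]
  exact div_le_of_le_mul₀ (sq_nonneg _) hc (h x)

theorem norm_inner_apply_self_le_numRadius (A : E →L[ℂ] E) (x : E) :
    ‖(⟪x, A x⟫)‖ ≤ numRadius A * ‖x‖ ^ 2 := by
  rcases eq_or_ne x 0 with rfl | hx
  · simp
  have hx' : 0 < ‖x‖ := norm_pos_iff.mpr hx
  have hbdd : BddAbove {r : ℝ | ∃ y : E, ‖y‖ = 1 ∧ r = ‖(⟪y, A y⟫)‖} := by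
    refine ⟨‖A‖, ?_⟩
    rintro _ ⟨y, hy, rfl⟩
    calc ‖(⟪y, A y⟫)‖ ≤ ‖y‖ * ‖A y‖ := norm_inner_le_norm _ _
      _ ≤ ‖A‖ := by simpa [hy] using A.le_opNorm y
  have hle := le_csSup hbdd ⟨((‖x‖⁻¹ : ℝ) : ℂ) • x, by simp [norm_smul, hx'.ne'], rfl⟩
  rw [map_smul, inner_smul_left, inner_smul_right, Complex.conj_ofReal, norm_mul, norm_mul,
    Complex.norm_real, norm_inv, norm_norm] at hle
  calc ‖(⟪x, A x⟫)‖ = ‖x‖⁻¹ * (‖x‖⁻¹ * ‖(⟪x, A x⟫)‖) * ‖x‖ ^ 2 := by field_simp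
    _ ≤ numRadius A * ‖x‖ ^ 2 := by gcongr; exact hle

theorem numRadius_nonneg (A : E →L[ℂ] E) : 0 ≤ numRadius A :=
  Real.sSup_nonneg fun _ ⟨_, _, hr⟩ => hr ▸ norm_nonneg _

theorem numRadius_smul_of_norm_eq_one (A : E →L[ℂ] E) {c : ℂ} (hc : ‖c‖ = 1) :
    numRadius (c • A) = numRadius A := by
  simp [numRadius, hc]

variable [CompleteSpace E]

theorem isSelfAdjoint_reOp (A : E →L[ℂ] E) : IsSelfAdjoint (reOp A) := by
  rw [isSelfAdjoint_iff', reOp, map_smulₛₗ, map_add, adjoint_adjoint, add_comm, map_inv₀,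
    Complex.conj_ofNat]

theorem re_inner_reOp_apply_self (A : E →L[ℂ] E) (x : E) :
    (⟪reOp A x, x⟫).re = (⟪x, A x⟫).re := by
  have h : ⟪reOp A x, x⟫ = (2 : ℂ)⁻¹ * (⟪A x, x⟫ + ⟪x, A x⟫) := by
    simp [reOp, adjoint_inner_left, mul_add, mul_comm]
  have h' : (⟪A x, x⟫).re = (⟪x, A x⟫).re := inner_re_symm (𝕜 := ℂ) _ _
  rw [h, show (2 : ℂ)⁻¹ = ((2⁻¹ : ℝ) : ℂ) by simp, Complex.re_ofReal_mul, Complex.add_re, h']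
  ring

theorem norm_reOp_le_numRadius (A : E →L[ℂ] E) : ‖reOp A‖ ≤ numRadius A := by
  refine norm_le_of_isSymmetric_of_abs_re_inner_le (isSelfAdjoint_reOp A).isSymmetric
    (numRadius_nonneg A) fun x => ?_
  rw [re_inner_reOp_apply_self]
  exact (Complex.abs_re_le_norm _).trans (norm_inner_apply_self_le_numRadius A x)

theorem imOp_eq_reOp_neg_I_smul (A : E →L[ℂ] E) : imOp A = reOp (-Complex.I • A) := by
  rw [imOp, reOp, map_smulₛₗ, map_neg, Complex.conj_I, neg_neg, neg_smul, mul_inv,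
    Complex.inv_I]
  module

theorem norm_imOp_le_numRadius (A : E →L[ℂ] E) : ‖imOp A‖ ≤ numRadius A := by
  rw [imOp_eq_reOp_neg_I_smul, ← numRadius_smul_of_norm_eq_one A (c := -Complex.I) (by simp)]
  exact norm_reOp_le_numRadius _

theorem reOp_add_I_smul_imOp (A : E →L[ℂ] E) : reOp A + Complex.I • imOp A = A := by
  rw [imOp_eq_reOp_neg_I_smul, reOp, reOp, map_smulₛₗ, map_neg, Complex.conj_I, neg_neg,
    smul_comm Complex.I, smul_add Complex.I, smul_smul, smul_smul, mul_neg, Complex.I_mul_I]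
  module

theorem norm_le_norm_reOp_add_norm_imOp (A : E →L[ℂ] E) : ‖A‖ ≤ ‖reOp A‖ + ‖imOp A‖ :=
  calc ‖A‖ = ‖reOp A + Complex.I • imOp A‖ := by rw [reOp_add_I_smul_imOp]
    _ ≤ ‖reOp A‖ + ‖imOp A‖ := (norm_add_le _ _).trans_eq (by simp [norm_smul])

/-- The parallelogram law for `A = Re A + i Im A` and `A* = Re A - i Im A`. -/
theorem norm_apply_sq_add_norm_adjoint_apply_sq (A : E →L[ℂ] E) (x : E) :
    ‖A x‖ ^ 2 + ‖adjoint A x‖ ^ 2 = 2 * (‖reOp A x‖ ^ 2 + ‖imOp A x‖ ^ 2) := by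
  have hp := parallelogram_law_with_norm ℂ (A x) (adjoint A x)
  have hr : ‖reOp A x‖ = 2⁻¹ * ‖A x + adjoint A x‖ := by simp [reOp, -smul_add, norm_smul]
  have hi : ‖imOp A x‖ = 2⁻¹ * ‖A x - adjoint A x‖ := by simp [imOp, norm_smul]
  rw [hr, hi]
  linarith

theorem re_inner_commutator (A : E →L[ℂ] E) (x : E) :
    (⟪(adjoint A ∘L A - A ∘L adjoint A) x, x⟫).re = ‖A x‖ ^ 2 - ‖adjoint A x‖ ^ 2 := by
  have h₁ : ‖A x‖ ^ 2 = (⟪(adjoint A ∘L A) x, x⟫).re :=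
    apply_norm_sq_eq_inner_adjoint_left A x
  have h₂ : ‖adjoint A x‖ ^ 2 = (⟪(adjoint (adjoint A) ∘L adjoint A) x, x⟫).re :=
    apply_norm_sq_eq_inner_adjoint_left (adjoint A) x
  rw [adjoint_adjoint] at h₂
  rw [h₁, h₂, sub_apply, inner_sub_left, Complex.sub_re]

theorem norm_adjoint_comp_self_sub_le (A : E →L[ℂ] E) :
    ‖adjoint A ∘L A - A ∘L adjoint A‖ ≤ ‖A‖ ^ 2 := by
  refine norm_le_of_isSymmetric_of_abs_re_inner_le (IsSelfAdjoint.isSymmetric ?_)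
    (sq_nonneg _) fun x => ?_
  · exact (IsSelfAdjoint.star_mul_self A).sub (IsSelfAdjoint.mul_star_self A)
  · rw [re_inner_commutator]
    have h₁ : ‖A x‖ ^ 2 ≤ ‖A‖ ^ 2 * ‖x‖ ^ 2 := by
      rw [← mul_pow]; gcongr; exact A.le_opNorm x
    have h₂ : ‖adjoint A x‖ ^ 2 ≤ ‖A‖ ^ 2 * ‖x‖ ^ 2 := by
      rw [← mul_pow, ← LinearIsometryEquiv.norm_map adjoint A]
      gcongr; exact (adjoint A).le_opNorm x
    rw [abs_le]
    constructor <;> nlinarith [sq_nonneg ‖A x‖, sq_nonneg ‖adjoint A x‖]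

theorem norm_adjoint_comp_self_sub_eq {A : E →L[ℂ] E} (h : numRadius A = ‖A‖ / 2) :
    ‖adjoint A ∘L A - A ∘L adjoint A‖ = ‖A‖ ^ 2 := by
  refine (norm_adjoint_comp_self_sub_le A).antisymm ?_
  set D := adjoint A ∘L A - A ∘L adjoint A with hD
  have key (x : E) : ‖A x‖ ^ 2 ≤ (‖D‖ + ‖A‖ ^ 2) / 2 * ‖x‖ ^ 2 := by
    have hr : ‖reOp A x‖ ^ 2 ≤ (‖A‖ / 2 * ‖x‖) ^ 2 := by
      gcongr; exact (reOp A).le_of_opNorm_le (h ▸ norm_reOp_le_numRadius A) x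
    have hi : ‖imOp A x‖ ^ 2 ≤ (‖A‖ / 2 * ‖x‖) ^ 2 := by
      gcongr; exact (imOp A).le_of_opNorm_le (h ▸ norm_imOp_le_numRadius A) x
    have hd : (⟪D x, x⟫).re ≤ ‖D‖ * ‖x‖ * ‖x‖ :=
      (Complex.re_le_norm _).trans <| (norm_inner_le_norm _ _).trans <| by
        gcongr; exact D.le_opNorm x
    rw [hD, re_inner_commutator, ← hD] at hd
    linarith [norm_apply_sq_add_norm_adjoint_apply_sq A x]
  have hA : ‖A‖ ≤ √((‖D‖ + ‖A‖ ^ 2) / 2) := by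
    refine A.opNorm_le_bound (Real.sqrt_nonneg _) fun x => ?_
    refine (sq_le_sq₀ (norm_nonneg _) (by positivity)).mp ?_
    rw [mul_pow, Real.sq_sqrt (by positivity)]
    exact key x
  have := Real.sq_sqrt (show 0 ≤ (‖D‖ + ‖A‖ ^ 2) / 2 by positivity)
  have := pow_le_pow_left₀ (norm_nonneg A) hA 2
  linarith

end

/-- If `w(A) = ‖A‖/2`, then for every `θ ∈ ℝ`,
`‖Re(e^{iθ}A)‖·‖Im(e^{iθ}A)‖ = (1/4)‖A*A − AA*‖`. -/
theorem stmt6 (A : H →L[ℂ] H) (h : numRadius A = ‖A‖ / 2) (θ : ℝ) :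
    ‖reOp (Complex.exp (θ * Complex.I) • A)‖ * ‖imOp (Complex.exp (θ * Complex.I) • A)‖ =
      (1 / 4) * ‖adjoint A ∘L A - A ∘L adjoint A‖ := by
  have hc : ‖Complex.exp (θ * Complex.I)‖ = 1 := Complex.norm_exp_ofReal_mul_I θ
  set B := Complex.exp (θ * Complex.I) • A with hB
  have hBn : ‖B‖ = ‖A‖ := by rw [hB, norm_smul, hc, one_mul]
  have hBw : numRadius B = ‖A‖ / 2 := by rw [hB, numRadius_smul_of_norm_eq_one A hc, h]
  have hre := norm_reOp_le_numRadius B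
  have him := norm_imOp_le_numRadius B
  have hsum := norm_le_norm_reOp_add_norm_imOp B
  rw [norm_adjoint_comp_self_sub_eq h, show ‖reOp B‖ = ‖A‖ / 2 by linarith,
    show ‖imOp B‖ = ‖A‖ / 2 by linarith]
  ring
end

section
/- For every A ∈ B(H), w(A)² ≥ (1/4)‖A*A + AA*‖ + (c(Re(A))² + c(Im(A))²)/2 + |(‖Re(A)‖² − ‖Im(A)‖²)/2 + (c(Im(A))² − c(Re(A))²)/2|. -/
open ContinuousLinearMap Filter
open scoped ComplexInnerProductSpace Topology

variable {H : Type*} [NormedAddCommGroup H] [InnerProductSpace ℂ H]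
  [CompleteSpace H] [Nontrivial H]

section

variable {E : Type*} [NormedAddCommGroup E] [InnerProductSpace ℂ E]

/-- A symmetric operator whose quadratic form is bounded on the unit sphere is bounded in norm. -/
theorem norm_sq_le_of_forall_norm_inner_sq_le [Nontrivial E] {S : E →L[ℂ] E}
    (hS : S.IsSymmetric) {M : ℝ} (hM : ∀ x : E, ‖x‖ = 1 → ‖(⟪x, S x⟫)‖ ^ 2 ≤ M) : ‖S‖ ^ 2 ≤ M := by
  obtain ⟨x₀, hx₀⟩ := exists_norm_eq E zero_le_one
  have hM0 : 0 ≤ M := (sq_nonneg _).trans (hM x₀ hx₀)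
  refine (Real.le_sqrt (norm_nonneg _) hM0).1 ?_
  rw [S.norm_eq_iSup_rayleighQuotient hS]
  refine ciSup_le fun x => ?_
  rcases eq_or_ne x 0 with rfl | hx
  · simp
  have hx' : (‖x‖⁻¹ : ℂ) ≠ 0 := by simpa using hx
  rw [← S.rayleigh_smul x hx']
  have h1 : ‖(‖x‖⁻¹ : ℂ) • x‖ = 1 := by
    rw [norm_smul]
    simp [hx]
  refine Real.le_sqrt_of_sq_le ((pow_le_pow_left₀ (abs_nonneg _) ?_ 2).trans (hM _ h1))
  rw [rayleighQuotient, h1, reApplyInnerSelf_apply, one_pow, div_one, norm_inner_symm]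
  exact RCLike.abs_re_le_norm _

theorem norm_inner_le_numRadius (A : E →L[ℂ] E) {x : E} (hx : ‖x‖ = 1) :
    ‖(⟪x, A x⟫)‖ ≤ numRadius A := by
  refine le_csSup ⟨‖A‖, ?_⟩ ⟨x, hx, rfl⟩
  rintro _ ⟨y, hy, rfl⟩
  simpa [hy] using (norm_inner_le_norm y (A y)).trans
    (mul_le_mul_of_nonneg_left (A.le_opNorm y) (norm_nonneg y))

theorem crawford_le_norm_inner (A : E →L[ℂ] E) {x : E} (hx : ‖x‖ = 1) :
    crawford A ≤ ‖(⟪x, A x⟫)‖ := by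
  refine csInf_le ⟨0, ?_⟩ ⟨x, hx, rfl⟩
  rintro _ ⟨y, -, rfl⟩
  exact norm_nonneg _

theorem crawford_nonneg (A : E →L[ℂ] E) : 0 ≤ crawford A := by
  refine Real.sInf_nonneg ?_
  rintro _ ⟨y, -, rfl⟩
  exact norm_nonneg _

variable [CompleteSpace E]

theorem inner_reOp_self (A : E →L[ℂ] E) (x : E) :
    ⟪x, reOp A x⟫ = ((⟪x, A x⟫).re : ℂ) := by
  rw [Complex.re_eq_add_conj, inner_conj_symm, ← adjoint_inner_right A x x]
  simp [reOp]
  ring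

theorem inner_imOp_self (A : E →L[ℂ] E) (x : E) :
    ⟪x, imOp A x⟫ = ((⟪x, A x⟫).im : ℂ) := by
  rw [Complex.im_eq_sub_conj, inner_conj_symm, ← adjoint_inner_right A x x]
  simp [imOp, inner_sub_right, inner_smul_right, Complex.inv_I, div_eq_mul_inv]
  ring

theorem isSymmetric_reOp (A : E →L[ℂ] E) : (reOp A).IsSymmetric :=
  (LinearMap.isSymmetric_iff_inner_map_self_real _).2 fun x => by
    have h := inner_reOp_self A x
    rw [inner_conj_symm]
    change ⟪x, reOp A x⟫ = ⟪reOp A x, x⟫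
    rw [← inner_conj_symm (reOp A x) x, h, Complex.conj_ofReal]

theorem isSymmetric_imOp (A : E →L[ℂ] E) : (imOp A).IsSymmetric :=
  (LinearMap.isSymmetric_iff_inner_map_self_real _).2 fun x => by
    have h := inner_imOp_self A x
    rw [inner_conj_symm]
    change ⟪x, imOp A x⟫ = ⟪imOp A x, x⟫
    rw [← inner_conj_symm (imOp A x) x, h, Complex.conj_ofReal]

/-- Cartesian decomposition of the quadratic form of `A`. -/
theorem norm_inner_reOp_sq_add_norm_inner_imOp_sq (A : E →L[ℂ] E) (x : E) :
    ‖(⟪x, reOp A x⟫)‖ ^ 2 + ‖(⟪x, imOp A x⟫)‖ ^ 2 = ‖(⟪x, A x⟫)‖ ^ 2 := by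
  rw [inner_reOp_self, inner_imOp_self, Complex.norm_real, Complex.norm_real,
    Real.norm_eq_abs, Real.norm_eq_abs, sq_abs, sq_abs, Complex.sq_norm, Complex.normSq_apply]
  ring

theorem adjoint_comp_self_add_self_comp_adjoint (A : E →L[ℂ] E) :
    adjoint A ∘L A + A ∘L adjoint A =
      (2 : ℂ) • (reOp A ∘L reOp A + imOp A ∘L imOp A) := by
  have hI : (Complex.I⁻¹ * (2 : ℂ)⁻¹) * (Complex.I⁻¹ * (2 : ℂ)⁻¹) = -(1 / 4) := by
    rw [Complex.inv_I]
    linear_combination (1 / 4 : ℂ) * Complex.I_mul_I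
  ext x
  simp only [reOp, imOp, add_apply, comp_apply, smul_apply, sub_apply, map_add, map_sub, map_smul,
    smul_add, smul_sub, smul_smul, mul_inv_rev, mul_assoc] at hI ⊢
  rw [hI]
  module

theorem norm_adjoint_comp_self_add_self_comp_adjoint_le (A : E →L[ℂ] E) :
    ‖adjoint A ∘L A + A ∘L adjoint A‖ ≤ 2 * (‖reOp A‖ ^ 2 + ‖imOp A‖ ^ 2) := by
  rw [adjoint_comp_self_add_self_comp_adjoint, norm_smul, Complex.norm_ofNat, sq, sq]
  gcongr
  exact (norm_add_le _ _).trans <| add_le_add (opNorm_comp_le _ _) (opNorm_comp_le _ _)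

theorem norm_reOp_sq_add_crawford_imOp_sq_le [Nontrivial E] (A : E →L[ℂ] E) :
    ‖reOp A‖ ^ 2 + crawford (imOp A) ^ 2 ≤ numRadius A ^ 2 := by
  refine le_sub_iff_add_le.1
    (norm_sq_le_of_forall_norm_inner_sq_le (isSymmetric_reOp A) fun x hx => ?_)
  have hc := pow_le_pow_left₀ (crawford_nonneg _) (crawford_le_norm_inner (imOp A) hx) 2
  have hw := pow_le_pow_left₀ (norm_nonneg _) (norm_inner_le_numRadius A hx) 2
  linarith [norm_inner_reOp_sq_add_norm_inner_imOp_sq A x]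

theorem norm_imOp_sq_add_crawford_reOp_sq_le [Nontrivial E] (A : E →L[ℂ] E) :
    ‖imOp A‖ ^ 2 + crawford (reOp A) ^ 2 ≤ numRadius A ^ 2 := by
  refine le_sub_iff_add_le.1
    (norm_sq_le_of_forall_norm_inner_sq_le (isSymmetric_imOp A) fun x hx => ?_)
  have hc := pow_le_pow_left₀ (crawford_nonneg _) (crawford_le_norm_inner (reOp A) hx) 2
  have hw := pow_le_pow_left₀ (norm_nonneg _) (norm_inner_le_numRadius A hx) 2
  linarith [norm_inner_reOp_sq_add_norm_inner_imOp_sq A x]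

end

/-- For every `A ∈ B(H)`,
`w(A)² ≥ (1/4)‖A*A + AA*‖ + (c(Re A)² + c(Im A)²)/2
  + |(‖Re A‖² − ‖Im A‖²)/2 + (c(Im A)² − c(Re A)²)/2|`. -/
theorem stmt9 (A : H →L[ℂ] H) :
    numRadius A ^ 2 ≥ (1 / 4) * ‖adjoint A ∘L A + A ∘L adjoint A‖ +
      (crawford (reOp A) ^ 2 + crawford (imOp A) ^ 2) / 2 +
      |(‖reOp A‖ ^ 2 - ‖imOp A‖ ^ 2) / 2 +
        (crawford (imOp A) ^ 2 - crawford (reOp A) ^ 2) / 2| := by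
  have hre := norm_reOp_sq_add_crawford_imOp_sq_le A
  have him := norm_imOp_sq_add_crawford_reOp_sq_le A
  have hA := norm_adjoint_comp_self_add_self_comp_adjoint_le A
  rw [ge_iff_le, ← le_sub_iff_add_le', abs_le]
  constructor <;> linarith
end
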